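/- Let H ∈ (1/2,1) and for t > 0, x ∈ (0,t) define k_t(x) = x^{1/2−H} ∫ₓᵗ u^{H−1/2} (u−x)^{H−3/2} du. Then for all t, s > 0, (H(2H−1) / B(2−2H, H−1/2)) · ∫₀^{min(t,s)} k_t(x) k_s(x) dx = R_H(t,s) = (1/2)(t^{2H} + s^{2H} − |t−s|^{2H}). (Volterra-type representation of the fBm covariance for H > 1/2.) -/

import Mathlib

open Real MeasureTheory

/-- The Volterra kernel of fractional Brownian motion for `H > 1/2` (up to
normalization): `k_t(x) = x^(1/2-H) ∫ₓᵗ u^(H-1/2) (u-x)^(H-3/2) du`. -/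
noncomputable def volterraKernel (H t x : ℝ) : ℝ :=
  x ^ (1/2 - H) * ∫ u in x..t, u ^ (H - 1/2) * (u - x) ^ (H - 3/2)

/-- The integrand of the Volterra kernel `k_t(x)` in the variable `u`, extended by zero outside
`0 < x < u`. -/
noncomputable def volterraIntegrand (H x u : ℝ) : ℝ :=
  if 0 < x ∧ x < u then x ^ (1/2 - H) * (u ^ (H - 1/2) * (u - x) ^ (H - 3/2)) else 0

lemma volterraIntegrand_nonneg (H x u : ℝ) : 0 ≤ volterraIntegrand H x u := by
  unfold volterraIntegrand
  split_ifs with h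
  · have := h.1.trans h.2
    have := sub_pos.2 h.2
    have := h.1
    positivity
  · rfl

lemma measurable_volterraIntegrand (H : ℝ) :
    Measurable fun p : ℝ × ℝ ↦ volterraIntegrand H p.1 p.2 := by
  unfold volterraIntegrand
  refine Measurable.ite ?_ (by fun_prop) measurable_const
  exact (measurableSet_lt measurable_const measurable_fst).inter
    (measurableSet_lt measurable_fst measurable_snd)

lemma volterraKernel_eq_toReal_lintegral {H t x : ℝ} (hx : 0 < x) (hxt : x < t) :
    volterraKernel H t x =
      (∫⁻ u in Set.Ioo 0 t, ENNReal.ofReal (volterraIntegrand H x u)).toReal := by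
  rw [← integral_eq_lintegral_of_nonneg_ae
    (.of_forall fun u ↦ volterraIntegrand_nonneg H x u)
    ((measurable_volterraIntegrand H).comp measurable_prodMk_left).aestronglyMeasurable,
    volterraKernel, ← intervalIntegral.integral_const_mul, intervalIntegral.integral_of_le hxt.le,
    integral_Ioc_eq_integral_Ioo]
  refine (setIntegral_congr_fun measurableSet_Ioo fun u hu ↦ ?_).trans
    (setIntegral_eq_of_subset_of_forall_sdiff_eq_zero measurableSet_Ioo
      (Set.Ioo_subset_Ioo_left hx.le) fun u hu ↦ ?_).symm
  · simp [volterraIntegrand, hx, hu.1]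
  · exact if_neg fun h ↦ hu.2 ⟨h.2, hu.1.2⟩

lemma lintegral_rpow_mul_one_sub_rpow {α β : ℝ} (hα : 0 < α) (hβ : 0 < β) :
    ∫⁻ x in Set.Ioo 0 1, ENNReal.ofReal (x ^ (α - 1) * (1 - x) ^ (β - 1)) =
      ENNReal.ofReal (ProbabilityTheory.beta α β) := by
  have hB := ProbabilityTheory.beta_pos hα hβ
  have h := ProbabilityTheory.lintegral_betaPDF_eq_one hα hβ
  rw [ProbabilityTheory.lintegral_betaPDF] at h
  simp_rw [mul_assoc, ENNReal.ofReal_mul (one_div_pos.2 hB).le] at h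
  rw [lintegral_const_mul' _ _ ENNReal.ofReal_ne_top] at h
  rw [← mul_one (ENNReal.ofReal (ProbabilityTheory.beta α β)), ← h, ← mul_assoc,
    ← ENNReal.ofReal_mul hB.le, mul_one_div_cancel hB.ne', ENNReal.ofReal_one, one_mul]

lemma abs_deriv_mul_volterraIntegrand_mul {H u v w : ℝ} (hv : 0 < v) (hvu : v < u)
    (hw : 0 < w) (hw' : w < 1) :
    u * v * (u - v) / (u - v * w) ^ 2 *
        (volterraIntegrand H (u * v * (1 - w) / (u - v * w)) u *
          volterraIntegrand H (u * v * (1 - w) / (u - v * w)) v) =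
      (u - v) ^ (2 * H - 2) * (w ^ (H - 1/2 - 1) * (1 - w) ^ (2 - 2 * H - 1)) := by
  have hu : 0 < u := hv.trans hvu
  have hE : 0 < u - v := sub_pos.2 hvu
  have hF : 0 < 1 - w := sub_pos.2 hw'
  have hD : 0 < u - v * w := by nlinarith
  have e1 : u - u * v * (1 - w) / (u - v * w) = u * (u - v) / (u - v * w) := by
    field_simp; ring
  have e2 : v - u * v * (1 - w) / (u - v * w) = v * w * (u - v) / (u - v * w) := by
    field_simp; ring
  have h0 : 0 < u * v * (1 - w) / (u - v * w) := by positivity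
  have h1 : u * v * (1 - w) / (u - v * w) < u := by
    rw [← sub_pos, e1]; positivity
  have h2 : u * v * (1 - w) / (u - v * w) < v := by
    rw [← sub_pos, e2]; positivity
  rw [volterraIntegrand, volterraIntegrand, if_pos ⟨h0, h1⟩, if_pos ⟨h0, h2⟩, e1, e2]
  generalize u - v * w = D at *
  generalize u - v = E at *
  generalize 1 - w = F at *
  clear h0 h1 h2 e1 e2 hvu hw'
  rw [← Real.exp_log hu, ← Real.exp_log hv, ← Real.exp_log hw, ← Real.exp_log hD,
    ← Real.exp_log hE, ← Real.exp_log hF]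
  simp only [← Real.exp_add, ← Real.exp_sub, ← Real.exp_mul, ← Real.exp_nat_mul]
  congr 1
  push_cast
  ring

lemma lintegral_volterraIntegrand_mul_of_lt {H u v : ℝ} (hH : H ∈ Set.Ioo (1/2 : ℝ) 1)
    (hv : 0 < v) (hvu : v < u) :
    ∫⁻ x, ENNReal.ofReal (volterraIntegrand H x u) * ENNReal.ofReal (volterraIntegrand H x v) =
      ENNReal.ofReal (ProbabilityTheory.beta (2 - 2 * H) (H - 1/2) * |u - v| ^ (2 * H - 2)) := by
  have hu : 0 < u := hv.trans hvu
  have hE : 0 < u - v := sub_pos.2 hvu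
  have hD {w : ℝ} (hw : w ∈ Set.Ioo (0 : ℝ) 1) : 0 < u - v * w := by nlinarith [hw.1, hw.2]
  set φ : ℝ → ℝ := fun w ↦ u * v * (1 - w) / (u - v * w) with hφ
  have himage : φ '' Set.Ioo 0 1 = Set.Ioo 0 v := by
    ext x
    constructor
    · rintro ⟨w, hw, rfl⟩
      have := hD hw
      have h1 : 0 < 1 - w := sub_pos.2 hw.2
      have h0 := hw.1
      refine ⟨by positivity, ?_⟩
      rw [← sub_pos, show v - φ w = v * w * (u - v) / (u - v * w) by
        simp only [hφ]; field_simp; ring]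
      positivity
    · rintro ⟨hx, hxv⟩
      have h1 : 0 < u - x := by linarith
      have h2 : 0 < v - x := by linarith
      have h3 : u * (v - x) / (v * (u - x)) ∈ Set.Ioo (0 : ℝ) 1 := by
        refine ⟨by positivity, ?_⟩
        rw [div_lt_one (by positivity)]
        nlinarith
      refine ⟨_, h3, ?_⟩
      have := hD h3
      simp only [hφ]
      rw [div_eq_iff this.ne']
      field_simp
      ring
  have hinj : Set.InjOn φ (Set.Ioo 0 1) := by
    intro w hw w' hw' h
    have h1 := hD hw
    have h2 := hD hw'
    simp only [hφ] at h
    rw [div_eq_div_iff h1.ne' h2.ne'] at h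
    have h3 : u * v * (u - v) * (w - w') = 0 := by linear_combination -h
    have h4 : u * v * (u - v) ≠ 0 := by positivity
    exact sub_eq_zero.1 ((mul_eq_zero.1 h3).resolve_left h4)
  have hderiv : ∀ w ∈ Set.Ioo (0 : ℝ) 1, HasDerivWithinAt φ
      (-(u * v * (u - v) / (u - v * w) ^ 2)) (Set.Ioo 0 1) w := by
    intro w hw
    have h1 : HasDerivAt (fun w : ℝ ↦ u * v * (1 - w)) (u * v * (-1)) w :=
      ((hasDerivAt_id w).const_sub 1).const_mul _
    have h2 : HasDerivAt (fun w : ℝ ↦ u - v * w) (-(v * 1)) w :=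
      ((hasDerivAt_id w).const_mul v).const_sub u
    refine ((h1.div h2 (hD hw).ne').congr_deriv ?_).hasDerivWithinAt
    have := hD hw
    field_simp
    ring
  rw [← setLIntegral_eq_of_support_subset (s := Set.Ioo 0 v), ← himage,
    lintegral_image_eq_lintegral_abs_deriv_mul measurableSet_Ioo hderiv hinj]
  · have hβ := lintegral_rpow_mul_one_sub_rpow (α := H - 1/2) (β := 2 - 2 * H)
      (by linarith [hH.1]) (by linarith [hH.2])
    rw [ProbabilityTheory.beta, mul_comm (Real.Gamma _), add_comm, ← ProbabilityTheory.beta] at hβ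
    rw [mul_comm (ProbabilityTheory.beta _ _), abs_of_pos hE, ENNReal.ofReal_mul (by positivity), ← hβ,
      ← lintegral_const_mul' _ _ ENNReal.ofReal_ne_top]
    refine setLIntegral_congr_fun measurableSet_Ioo fun w hw ↦ ?_
    have := hD hw
    rw [← ENNReal.ofReal_mul (volterraIntegrand_nonneg ..), ← ENNReal.ofReal_mul (abs_nonneg _),
      ← ENNReal.ofReal_mul (by positivity), abs_neg, abs_of_pos (by positivity),
      abs_deriv_mul_volterraIntegrand_mul hv hvu hw.1 hw.2]
  · intro x hx
    by_contra h
    refine hx ?_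
    simp only [volterraIntegrand]
    rw [if_neg (c := 0 < x ∧ x < v) (fun h' ↦ h h')]
    simp

lemma lintegral_volterraIntegrand_mul {H u v : ℝ} (hH : H ∈ Set.Ioo (1/2 : ℝ) 1)
    (hu : 0 < u) (hv : 0 < v) (huv : u ≠ v) :
    ∫⁻ x, ENNReal.ofReal (volterraIntegrand H x u) * ENNReal.ofReal (volterraIntegrand H x v) =
      ENNReal.ofReal (ProbabilityTheory.beta (2 - 2 * H) (H - 1/2) * |u - v| ^ (2 * H - 2)) := by
  rcases huv.lt_or_gt with h | h
  · simp_rw [mul_comm (ENNReal.ofReal (volterraIntegrand H _ u)), abs_sub_comm u v]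
    exact lintegral_volterraIntegrand_mul_of_lt hH hu h
  · exact lintegral_volterraIntegrand_mul_of_lt hH hv h

lemma lintegral_ofReal_Ioo_eq {f : ℝ → ℝ} {t : ℝ} (ht : 0 ≤ t) (hf : ∀ u ∈ Set.Ioo 0 t, 0 ≤ f u)
    (hfi : IntervalIntegrable f volume 0 t) :
    ∫⁻ u in Set.Ioo 0 t, ENNReal.ofReal (f u) = ENNReal.ofReal (∫ u in 0..t, f u) := by
  rw [intervalIntegral.integral_of_le ht, integral_Ioc_eq_integral_Ioo,
    ofReal_integral_eq_lintegral_ofReal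
      ((intervalIntegrable_iff_integrableOn_Ioo_of_le ht).1 hfi)
      (ae_restrict_of_forall_mem measurableSet_Ioo hf)]

lemma lintegral_abs_sub_rpow {r t v : ℝ} (hr : -1 < r) (hv : 0 ≤ v) (hvt : v ≤ t) :
    ∫⁻ u in Set.Ioo 0 t, ENNReal.ofReal (|u - v| ^ r) =
      ENNReal.ofReal ((v ^ (r + 1) + (t - v) ^ (r + 1)) / (r + 1)) := by
  have hl : Set.EqOn (fun u ↦ (v - u) ^ r) (fun u ↦ |u - v| ^ r) (Set.uIcc 0 v) := by
    intro u hu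
    rw [Set.uIcc_of_le hv] at hu
    simp only [abs_sub_comm u v, abs_of_nonneg (sub_nonneg.2 hu.2)]
  have hr' : Set.EqOn (fun u ↦ (u - v) ^ r) (fun u ↦ |u - v| ^ r) (Set.uIcc v t) := by
    intro u hu
    rw [Set.uIcc_of_le hvt] at hu
    simp only [abs_of_nonneg (sub_nonneg.2 hu.1)]
  have il : IntervalIntegrable (fun u ↦ |u - v| ^ r) volume 0 v := by
    have h := (intervalIntegral.intervalIntegrable_rpow' (a := v) (b := 0) hr).comp_sub_left v
    rw [sub_self, sub_zero] at h
    exact h.congr (hl.mono Set.uIoc_subset_uIcc)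
  have ir : IntervalIntegrable (fun u ↦ |u - v| ^ r) volume v t := by
    have h := (intervalIntegral.intervalIntegrable_rpow' (a := 0) (b := t - v) hr).comp_sub_right v
    rw [zero_add, sub_add_cancel] at h
    exact h.congr (hr'.mono Set.uIoc_subset_uIcc)
  rw [lintegral_ofReal_Ioo_eq (hv.trans hvt) (fun u _ ↦ by positivity) (il.trans ir),
    ← intervalIntegral.integral_add_adjacent_intervals il ir,
    ← intervalIntegral.integral_congr hl, ← intervalIntegral.integral_congr hr',
    intervalIntegral.integral_comp_sub_left (fun x ↦ x ^ r),
    intervalIntegral.integral_comp_sub_right (fun x ↦ x ^ r),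
    integral_rpow (.inl hr), integral_rpow (.inl hr)]
  simp [Real.zero_rpow (by linarith : r + 1 ≠ 0), add_div]

lemma lintegral_lintegral_abs_sub_rpow {r s t : ℝ} (hr : -1 < r) (hs : 0 ≤ s) (hst : s ≤ t) :
    ∫⁻ v in Set.Ioo 0 s, ∫⁻ u in Set.Ioo 0 t, ENNReal.ofReal (|u - v| ^ r) =
      ENNReal.ofReal ((s ^ (r + 2) + t ^ (r + 2) - (t - s) ^ (r + 2)) / ((r + 1) * (r + 2))) := by
  have h1 : -1 < r + 1 := by linarith
  have i1 := intervalIntegral.intervalIntegrable_rpow' (a := 0) (b := s) h1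
  have i2 : IntervalIntegrable (fun v ↦ (t - v) ^ (r + 1)) volume 0 s := by
    have h := (intervalIntegral.intervalIntegrable_rpow' (a := t) (b := t - s) h1).comp_sub_left t
    rwa [sub_self, sub_sub_cancel] at h
  rw [setLIntegral_congr_fun measurableSet_Ioo fun v hv ↦
      lintegral_abs_sub_rpow hr hv.1.le (hv.2.le.trans hst),
    lintegral_ofReal_Ioo_eq hs _ ((i1.add i2).div_const _)]
  · rw [intervalIntegral.integral_div, intervalIntegral.integral_add i1 i2,
      intervalIntegral.integral_comp_sub_left (fun x ↦ x ^ (r + 1)),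
      integral_rpow (.inl h1), integral_rpow (.inl h1), add_assoc, one_add_one_eq_two,
      Real.zero_rpow (by linarith : r + 2 ≠ 0), sub_zero, sub_zero, ← add_div, div_div,
      mul_comm (r + 2), add_sub_assoc]
  · intro v hv
    have h2 := hv.1
    have h3 : 0 < t - v := by linarith [hv.2]
    have h4 : 0 < r + 1 := by linarith
    positivity

lemma lintegral_mul_lintegral_volterraIntegrand {H s t : ℝ} (hH : H ∈ Set.Ioo (1/2 : ℝ) 1)
    (hs : 0 ≤ s) (hst : s ≤ t) :
    ∫⁻ x, (∫⁻ u in Set.Ioo 0 t, ENNReal.ofReal (volterraIntegrand H x u)) *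
        ∫⁻ v in Set.Ioo 0 s, ENNReal.ofReal (volterraIntegrand H x v) =
      ENNReal.ofReal (ProbabilityTheory.beta (2 - 2 * H) (H - 1/2)) *
        ENNReal.ofReal ((s ^ (2 * H) + t ^ (2 * H) - (t - s) ^ (2 * H)) /
          ((2 * H - 1) * (2 * H))) := by
  have hβ := ProbabilityTheory.beta_pos (α := 2 - 2 * H) (β := H - 1/2)
    (by linarith [hH.2]) (by linarith [hH.1])
  have hm : Measurable fun p : ℝ × ℝ ↦ ENNReal.ofReal (volterraIntegrand H p.1 p.2) :=
    (measurable_volterraIntegrand H).ennreal_ofReal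
  have hmx (x : ℝ) : Measurable fun u ↦ ENNReal.ofReal (volterraIntegrand H x u) :=
    hm.comp measurable_prodMk_left
  have hm₃ : Measurable fun p : (ℝ × ℝ) × ℝ ↦ ENNReal.ofReal (volterraIntegrand H p.1.1 p.2) *
      ENNReal.ofReal (volterraIntegrand H p.1.1 p.1.2) :=
    (hm.comp (by fun_prop : Measurable fun p : (ℝ × ℝ) × ℝ ↦ (p.1.1, p.2))).mul
      (hm.comp (by fun_prop : Measurable fun p : (ℝ × ℝ) × ℝ ↦ (p.1.1, p.1.2)))
  calc
    _ = ∫⁻ x, ∫⁻ v in Set.Ioo 0 s, ∫⁻ u in Set.Ioo 0 t,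
          ENNReal.ofReal (volterraIntegrand H x u) * ENNReal.ofReal (volterraIntegrand H x v) := by
      refine lintegral_congr fun x ↦ ?_
      rw [← lintegral_const_mul _ (hmx x)]
      exact lintegral_congr fun v ↦ (lintegral_mul_const _ (hmx x)).symm
    _ = ∫⁻ v in Set.Ioo 0 s, ∫⁻ u in Set.Ioo 0 t, ∫⁻ x,
          ENNReal.ofReal (volterraIntegrand H x u) * ENNReal.ofReal (volterraIntegrand H x v) := by
      rw [lintegral_lintegral_swap]
      · refine lintegral_congr fun v ↦ lintegral_lintegral_swap (Measurable.aemeasurable ?_)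
        exact hm₃.comp (by fun_prop : Measurable fun p : ℝ × ℝ ↦ ((p.1, v), p.2))
      · exact hm₃.lintegral_prod_right'.aemeasurable
    _ = ∫⁻ v in Set.Ioo 0 s, ENNReal.ofReal (ProbabilityTheory.beta (2 - 2 * H) (H - 1/2)) *
          ∫⁻ u in Set.Ioo 0 t, ENNReal.ofReal (|u - v| ^ (2 * H - 2)) := by
      refine setLIntegral_congr_fun measurableSet_Ioo fun v hv ↦ ?_
      rw [← lintegral_const_mul' _ _ ENNReal.ofReal_ne_top]
      refine setLIntegral_congr_fun_ae measurableSet_Ioo ?_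
      filter_upwards [Measure.ae_ne volume v] with u huv hu
      rw [lintegral_volterraIntegrand_mul hH hu.1 hv.1 huv, ENNReal.ofReal_mul hβ.le]
    _ = _ := by
      rw [lintegral_const_mul' _ _ ENNReal.ofReal_ne_top,
        lintegral_lintegral_abs_sub_rpow (by linarith [hH.1]) hs hst]
      ring_nf

lemma integral_volterraKernel_mul {H s t : ℝ} (hH : H ∈ Set.Ioo (1/2 : ℝ) 1)
    (hs : 0 ≤ s) (hst : s ≤ t) :
    ∫ x in 0..s, volterraKernel H t x * volterraKernel H s x =
      ProbabilityTheory.beta (2 - 2 * H) (H - 1/2) *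
        ((s ^ (2 * H) + t ^ (2 * H) - (t - s) ^ (2 * H)) / ((2 * H - 1) * (2 * H))) := by
  have hH1 : 0 < 2 * H - 1 := by linarith [hH.1]
  have hβ := ProbabilityTheory.beta_pos (α := 2 - 2 * H) (β := H - 1/2)
    (by linarith [hH.2]) (by linarith [hH.1])
  have hm (t : ℝ) : Measurable fun x ↦
      ∫⁻ u in Set.Ioo 0 t, ENNReal.ofReal (volterraIntegrand H x u) :=
    (measurable_volterraIntegrand H).ennreal_ofReal.lintegral_prod_right'
  have key := lintegral_mul_lintegral_volterraIntegrand hH hs hst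
  rw [← setLIntegral_eq_of_support_subset (s := Set.Ioo 0 s)] at key
  · have hnn : 0 ≤ (s ^ (2 * H) + t ^ (2 * H) - (t - s) ^ (2 * H)) / ((2 * H - 1) * (2 * H)) := by
      have h1 : (t - s) ^ (2 * H) ≤ t ^ (2 * H) :=
        Real.rpow_le_rpow (by linarith) (by linarith) (by linarith)
      have h2 : 0 ≤ s ^ (2 * H) := by positivity
      exact div_nonneg (by linarith) (by nlinarith)
    rw [intervalIntegral.integral_of_le hs, integral_Ioc_eq_integral_Ioo,
      setIntegral_congr_fun measurableSet_Ioo fun x hx ↦ by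
        rw [volterraKernel_eq_toReal_lintegral hx.1 (hx.2.trans_le hst),
          volterraKernel_eq_toReal_lintegral hx.1 hx.2, ← ENNReal.toReal_mul],
      integral_toReal ((hm t).fun_mul (hm s)).aemeasurable, key, ENNReal.toReal_mul,
      ENNReal.toReal_ofReal hβ.le, ENNReal.toReal_ofReal hnn]
    exact ae_lt_top ((hm t).mul (hm s)) (by rw [key]; finiteness)
  · intro x hx
    by_contra h
    refine hx ?_
    refine mul_eq_zero_of_right _ (setLIntegral_eq_zero measurableSet_Ioo fun v hv ↦ ?_)
    simp only [volterraIntegrand]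
    rw [if_neg fun h' ↦ h ⟨h'.1, h'.2.trans hv.2⟩]
    simp

/-- Volterra-type representation of the fBm covariance for `H > 1/2`:
`(H(2H-1)/B(2-2H, H-1/2)) ∫₀^(min t s) k_t(x) k_s(x) dx = R_H(t,s)`,
where `B(a,b) = Γ(a)Γ(b)/Γ(a+b)`. -/
theorem volterra_representation_covariance (H : ℝ) (hH : H ∈ Set.Ioo (1/2 : ℝ) 1)
    (t s : ℝ) (ht : 0 < t) (hs : 0 < s) :
    (H * (2*H - 1) /
        (Real.Gamma (2 - 2*H) * Real.Gamma (H - 1/2)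
          / Real.Gamma ((2 - 2*H) + (H - 1/2)))) *
      (∫ x in (0:ℝ)..(min t s), volterraKernel H t x * volterraKernel H s x) =
      (1/2) * (t ^ (2*H) + s ^ (2*H) - |t - s| ^ (2*H)) := by
  wlog hst : s ≤ t generalizing s t
  · have := this s t hs ht (le_of_not_ge hst)
    rw [min_comm, abs_sub_comm, add_comm (t ^ _)]
    simpa only [mul_comm (volterraKernel H t _)] using this
  have hH1 : 0 < 2 * H - 1 := by linarith [hH.1]
  have hH0 : 0 < H := by linarith
  have hβ := ProbabilityTheory.beta_pos (α := 2 - 2 * H) (β := H - 1/2)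
    (by linarith [hH.2]) (by linarith [hH.1])
  rw [min_eq_right hst, integral_volterraKernel_mul hH hs.le hst,
    abs_of_nonneg (sub_nonneg.2 hst), ← ProbabilityTheory.beta]
  generalize ProbabilityTheory.beta _ _ = b at *
  have : H * 2 - 1 ≠ 0 := by linarith
  field_simp
  ring
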